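/- Every additive subgroup G of ℝ has the Lipschitz Clustering Property; furthermore, for any interval I ⊂ ℝ, the set G ∩ I (if nonempty) has the Lipschitz Clustering Property. In fact, for each n ≥ 2 the map r(A) = { x − δ_n(A)·s_A(x) : x ∈ A }, where s_A(x) = |A ∩ (−∞,x)|, restricts to a (4n−3)-Lipschitz retraction of G(n) onto G(n−1) and of (G ∩ I)(n) onto (G ∩ I)(n−1). -/

import Mathlib

/-- The minimum separation function `δ_n` on finite subsets of `ℝ`:
`δ_n(A) = 0` if `|A| ≠ n`, and `δ_n(A)` is the minimal distance between
two distinct points of `A` if `|A| = n`. -/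
noncomputable def minSep (n : ℕ) (A : Finset ℝ) : ℝ :=
  if A.card = n then sInf {d : ℝ | ∃ a ∈ A, ∃ b ∈ A, a ≠ b ∧ d = dist a b} else 0

/-- `s_A(x) = |A ∩ (-∞, x)|`, the number of points of `A` below `x`. -/
noncomputable def countBelow (A : Finset ℝ) (x : ℝ) : ℕ :=
  (A.filter fun y => y < x).card

/-- The retraction `r(A) = { x - δ_n(A) s_A(x) : x ∈ A }` of `ℝ(n)` onto `ℝ(n-1)`. -/
noncomputable def lineRetract (n : ℕ) (A : Finset ℝ) : Finset ℝ :=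
  A.image fun x => x - minSep n A * (countBelow A x : ℝ)

theorem minSep_of_card_ne {n : ℕ} {A : Finset ℝ} (h : A.card ≠ n) : minSep n A = 0 :=
  if_neg h

theorem minSep_nonneg (n : ℕ) (A : Finset ℝ) : 0 ≤ minSep n A := by
  unfold minSep
  split_ifs
  · apply Real.sInf_nonneg
    rintro d ⟨a, -, b, -, -, rfl⟩
    exact dist_nonneg
  · exact le_rfl

theorem minSep_le_dist (n : ℕ) {A : Finset ℝ} {a b : ℝ} (ha : a ∈ A) (hb : b ∈ A)
    (hab : a ≠ b) : minSep n A ≤ dist a b := by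
  unfold minSep
  split_ifs
  · refine csInf_le ⟨0, ?_⟩ ⟨a, ha, b, hb, hab, rfl⟩
    rintro d ⟨a, -, b, -, -, rfl⟩
    exact dist_nonneg
  · exact dist_nonneg

theorem minSep_le_sub (n : ℕ) {A : Finset ℝ} {a b : ℝ} (ha : a ∈ A) (hb : b ∈ A)
    (hab : a < b) : minSep n A ≤ b - a := by
  have h := minSep_le_dist n hb ha hab.ne'
  rwa [Real.dist_eq, abs_of_pos (sub_pos.2 hab)] at h

theorem exists_minSep_eq_sub {n : ℕ} (hn : 2 ≤ n) {A : Finset ℝ} (hA : A.card = n) :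
    ∃ a ∈ A, ∃ b ∈ A, a < b ∧ minSep n A = b - a := by
  have hne : {d : ℝ | ∃ a ∈ A, ∃ b ∈ A, a ≠ b ∧ d = dist a b}.Nonempty := by
    obtain ⟨a, ha, b, hb, hab⟩ := Finset.one_lt_card.1 (by omega : 1 < A.card)
    exact ⟨_, a, ha, b, hb, hab, rfl⟩
  have hfin : {d : ℝ | ∃ a ∈ A, ∃ b ∈ A, a ≠ b ∧ d = dist a b}.Finite := by
    refine ((A ×ˢ A).image fun p => dist p.1 p.2).finite_toSet.subset ?_
    rintro d ⟨a, ha, b, hb, -, rfl⟩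
    exact Finset.mem_coe.2 (Finset.mem_image.2 ⟨(a, b), Finset.mem_product.2 ⟨ha, hb⟩, rfl⟩)
  obtain ⟨a, ha, b, hb, hab, h⟩ := hne.csInf_mem hfin
  have hs : minSep n A = dist a b := (if_pos hA).trans h
  rcases lt_or_gt_of_ne hab with hlt | hlt
  · exact ⟨a, ha, b, hb, hlt, by rw [hs, dist_comm, Real.dist_eq, abs_of_pos (sub_pos.2 hlt)]⟩
  · exact ⟨b, hb, a, ha, hlt, by rw [hs, Real.dist_eq, abs_of_pos (sub_pos.2 hlt)]⟩

theorem countBelow_lt_card {A : Finset ℝ} {x : ℝ} (hx : x ∈ A) : countBelow A x < A.card :=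
  Finset.card_lt_card (Finset.filter_ssubset.2 ⟨x, hx, lt_irrefl x⟩)

theorem countBelow_eq_succ {A : Finset ℝ} {x y : ℝ} (hy : y ∈ A) (hyx : y < x)
    (h : ∀ c ∈ A, c < x → c ≤ y) : countBelow A x = countBelow A y + 1 := by
  have : A.filter (fun c => c < x) = insert y (A.filter fun c => c < y) := by
    ext c
    simp only [Finset.mem_filter, Finset.mem_insert]
    constructor
    · rintro ⟨hc, hcx⟩
      exact (h c hc hcx).eq_or_lt.imp_right fun hlt => ⟨hc, hlt⟩
    · rintro (rfl | ⟨hc, hcy⟩)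
      · exact ⟨hy, hyx⟩
      · exact ⟨hc, hcy.trans hyx⟩
  rw [countBelow, this, Finset.card_insert_of_notMem (by simp), countBelow]

theorem exists_add_minSep_mul_countBelow_le (n : ℕ) {A : Finset ℝ} {x : ℝ} (hx : x ∈ A) :
    ∃ m ∈ A, m + minSep n A * countBelow A x ≤ x := by
  induction hk : countBelow A x generalizing x with
  | zero => exact ⟨x, hx, by simp⟩
  | succ k ih =>
    have hne : (A.filter fun y => y < x).Nonempty := by
      rw [← Finset.card_pos]
      change 0 < countBelow A x
      omega
    obtain ⟨y, hy, hmax⟩ := (A.filter fun y => y < x).exists_max_image id hne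
    obtain ⟨hyA, hyx⟩ := Finset.mem_filter.1 hy
    have hs := countBelow_eq_succ hyA hyx fun c hc hcx =>
      hmax c (Finset.mem_filter.2 ⟨hc, hcx⟩)
    obtain ⟨m, hm, hle⟩ := ih hyA (by omega)
    refine ⟨m, hm, ?_⟩
    have := minSep_le_sub n hyA hx hyx
    push_cast
    linarith

theorem lineRetract_of_card_ne {n : ℕ} {A : Finset ℝ} (h : A.card ≠ n) :
    lineRetract n A = A := by
  simp [lineRetract, minSep_of_card_ne h]

theorem card_lineRetract_le {n : ℕ} (hn : 2 ≤ n) {A : Finset ℝ} (hA : A.card ≤ n) :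
    (lineRetract n A).card ≤ n - 1 := by
  by_cases h : A.card = n
  · have hle : (lineRetract n A).card ≤ A.card := Finset.card_image_le
    suffices (lineRetract n A).card ≠ A.card by omega
    intro heq
    obtain ⟨a, ha, b, hb, hab, hs⟩ := exists_minSep_eq_sub hn h
    refine hab.ne (Finset.card_image_iff.1 heq ha hb ?_)
    have hcount : countBelow A b = countBelow A a + 1 :=
      countBelow_eq_succ ha hab fun c hc hcb => by
        by_contra! hac
        linarith [minSep_le_sub n ha hc hac]
    simp only [hcount, hs]
    push_cast
    ring
  · rw [lineRetract_of_card_ne h]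
    omega

theorem lineRetract_subset_addSubgroup {n : ℕ} (hn : 2 ≤ n) (G : AddSubgroup ℝ)
    {A : Finset ℝ} (hA : (A : Set ℝ) ⊆ G) : (lineRetract n A : Set ℝ) ⊆ G := by
  have hs : minSep n A ∈ G := by
    by_cases h : A.card = n
    · obtain ⟨a, ha, b, hb, -, hs⟩ := exists_minSep_eq_sub hn h
      rw [hs]
      exact G.sub_mem (hA hb) (hA ha)
    · rw [minSep_of_card_ne h]
      exact G.zero_mem
  intro z hz
  obtain ⟨x, hx, rfl⟩ := Finset.mem_image.1 (Finset.mem_coe.1 hz)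
  refine G.sub_mem (hA hx) ?_
  rw [mul_comm, ← nsmul_eq_mul]
  exact G.nsmul_mem hs _

theorem lineRetract_subset_ordConnected (n : ℕ) {I : Set ℝ} (hI : I.OrdConnected)
    {A : Finset ℝ} (hA : (A : Set ℝ) ⊆ I) : (lineRetract n A : Set ℝ) ⊆ I := by
  intro z hz
  obtain ⟨x, hx, rfl⟩ := Finset.mem_image.1 (Finset.mem_coe.1 hz)
  obtain ⟨m, hm, hle⟩ := exists_add_minSep_mul_countBelow_le n hx
  have := mul_nonneg (minSep_nonneg n A) (countBelow A x).cast_nonneg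
  exact hI.out (hA hm) (hA hx) ⟨by linarith, by linarith⟩

/-- A map that displaces the points of a well-separated `n`-point set `A` by at most `D` is a
bijection onto any set of at most `n` points containing its values, and it nearly commutes
with the retraction. -/
theorem image_eq_and_dist_lineRetract_le {n : ℕ} (hn : 2 ≤ n) {A B : Finset ℝ}
    (hA : A.card = n) (hB : B.card ≤ n) {D : ℝ} (hD : 2 * D < minSep n A) {f : ℝ → ℝ}
    (hfB : ∀ a ∈ A, f a ∈ B) (hf : ∀ a ∈ A, |a - f a| ≤ D) :
    A.image f = B ∧ ∀ a ∈ A,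
      |(a - minSep n A * countBelow A a) - (f a - minSep n B * countBelow B (f a))| ≤
        (2 * n - 1) * D := by
  have hmono : StrictMonoOn f A := fun a ha b hb hab => by
    have h1 := abs_le.1 (hf a ha)
    have h2 := abs_le.1 (hf b hb)
    linarith [minSep_le_sub n ha hb hab, h1.1, h2.2]
  have hcard : (A.image f).card = n := by
    rw [Finset.card_image_of_injOn hmono.injOn, hA]
  have himage : A.image f = B :=
    Finset.eq_of_subset_of_card_le (Finset.image_subset_iff.2 hfB) (by omega)
  refine ⟨himage, fun a ha => ?_⟩
  have hcount : countBelow B (f a) = countBelow A a := by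
    have : B.filter (fun y => y < f a) = (A.filter fun y => y < a).image f := by
      rw [← himage, Finset.filter_image]
      congr 1
      exact Finset.filter_congr fun c hc => hmono.lt_iff_lt hc ha
    rw [countBelow, this, Finset.card_image_of_injOn, countBelow]
    exact hmono.injOn.mono (Finset.coe_subset.2 (Finset.filter_subset _ _))
  have hsep : |minSep n A - minSep n B| ≤ 2 * D := by
    rw [abs_le]
    constructor
    · obtain ⟨b, hb, c, hc, hbc, hs⟩ := exists_minSep_eq_sub hn hA
      have := minSep_le_sub n (hfB b hb) (hfB c hc) (hmono hb hc hbc)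
      linarith [(abs_le.1 (hf b hb)).2, (abs_le.1 (hf c hc)).1]
    · obtain ⟨y, hy, z, hz, hyz, hs⟩ := exists_minSep_eq_sub hn (himage ▸ hcard : B.card = n)
      rw [← himage] at hy hz
      obtain ⟨b, hb, rfl⟩ := Finset.mem_image.1 hy
      obtain ⟨c, hc, rfl⟩ := Finset.mem_image.1 hz
      have := minSep_le_sub n hb hc ((hmono.lt_iff_lt hb hc).1 hyz)
      linarith [(abs_le.1 (hf b hb)).1, (abs_le.1 (hf c hc)).2]
  have hk : (countBelow A a : ℝ) ≤ n - 1 := by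
    have := countBelow_lt_card ha
    rw [hA] at this
    rw [le_sub_iff_add_le]
    exact_mod_cast this
  have hmul : |(minSep n A - minSep n B) * countBelow A a| ≤ 2 * D * (n - 1) := by
    rw [abs_mul, Nat.abs_cast]
    exact mul_le_mul hsep hk (Nat.cast_nonneg _) ((abs_nonneg _).trans hsep)
  rw [hcount, show (a - minSep n A * countBelow A a) - (f a - minSep n B * countBelow A a) =
    (a - f a) - (minSep n A - minSep n B) * countBelow A a by ring]
  linarith [abs_sub (a - f a) ((minSep n A - minSep n B) * countBelow A a), hf a ha]

theorem minSep_mul_countBelow_mem_Icc {n : ℕ} {A : Finset ℝ} (hA : A.card ≤ n) {D : ℝ}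
    (hD : minSep n A ≤ 2 * D) {a : ℝ} (ha : a ∈ A) :
    minSep n A * countBelow A a ∈ Set.Icc 0 (2 * D * (n - 1)) := by
  have hk : (countBelow A a : ℝ) ≤ n - 1 := by
    have := (countBelow_lt_card ha).trans_le hA
    rw [le_sub_iff_add_le]
    exact_mod_cast this
  exact ⟨mul_nonneg (minSep_nonneg n A) (Nat.cast_nonneg _),
    mul_le_mul hD hk (Nat.cast_nonneg _) ((minSep_nonneg n A).trans hD)⟩

theorem exists_mem_lineRetract_dist_le {n : ℕ} (hn : 2 ≤ n) {A B : Finset ℝ}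
    (hA : A.card ≤ n) (hB : B.card ≤ n) {D : ℝ} (hD : 0 ≤ D)
    (hAB : ∀ a ∈ A, ∃ b ∈ B, |a - b| ≤ D) (hBA : ∀ b ∈ B, ∃ a ∈ A, |b - a| ≤ D) :
    ∀ x ∈ lineRetract n A, ∃ y ∈ lineRetract n B, dist x y ≤ (2 * n - 1) * D := by
  intro x hx
  obtain ⟨a, ha, rfl⟩ := Finset.mem_image.1 hx
  choose! f hfB hf using hAB
  choose! g hgA hg using hBA
  by_cases h1 : 2 * D < minSep n A
  · have hcard : A.card = n := by
      by_contra h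
      rw [minSep_of_card_ne h] at h1
      linarith
    exact ⟨_, Finset.mem_image_of_mem _ (hfB a ha),
      (image_eq_and_dist_lineRetract_le hn hcard hB h1 hfB hf).2 a ha⟩
  by_cases h2 : 2 * D < minSep n B
  · have hcard : B.card = n := by
      by_contra h
      rw [minSep_of_card_ne h] at h2
      linarith
    obtain ⟨himage, hdist⟩ := image_eq_and_dist_lineRetract_le hn hcard hA h2 hgA hg
    rw [← himage] at ha
    obtain ⟨b, hb, rfl⟩ := Finset.mem_image.1 ha
    refine ⟨_, Finset.mem_image_of_mem _ hb, ?_⟩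
    rw [dist_comm]
    exact hdist b hb
  · refine ⟨_, Finset.mem_image_of_mem _ (hfB a ha), ?_⟩
    obtain ⟨hA0, hA1⟩ := minSep_mul_countBelow_mem_Icc hA (not_lt.1 h1) ha
    obtain ⟨hB0, hB1⟩ := minSep_mul_countBelow_mem_Icc hB (not_lt.1 h2) (hfB a ha)
    have := abs_le.1 (hf a ha)
    rw [Real.dist_eq, abs_le]
    constructor <;> linarith

theorem exists_dist_le_hausdorffDist {A B : Finset ℝ} (hA : A.Nonempty) (hB : B.Nonempty) :
    ∀ a ∈ A, ∃ b ∈ B, |a - b| ≤ Metric.hausdorffDist (A : Set ℝ) (B : Set ℝ) := by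
  intro a ha
  obtain ⟨b, hb, h⟩ := B.finite_toSet.isCompact.exists_infDist_eq_dist hB a
  refine ⟨b, hb, ?_⟩
  rw [← Real.dist_eq, ← h]
  exact Metric.infDist_le_hausdorffDist_of_mem ha
    (Metric.hausdorffEDist_ne_top_of_nonempty_of_bounded hA hB
      A.finite_toSet.isBounded B.finite_toSet.isBounded)

theorem hausdorffDist_lineRetract_le {n : ℕ} (hn : 2 ≤ n) {A B : Finset ℝ}
    (hA : A.Nonempty) (hAn : A.card ≤ n) (hB : B.Nonempty) (hBn : B.card ≤ n) :
    Metric.hausdorffDist (lineRetract n A : Set ℝ) (lineRetract n B : Set ℝ) ≤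
      (2 * n - 1) * Metric.hausdorffDist (A : Set ℝ) (B : Set ℝ) := by
  have hD : 0 ≤ Metric.hausdorffDist (A : Set ℝ) (B : Set ℝ) := Metric.hausdorffDist_nonneg
  have hn' : (2 : ℝ) ≤ n := by exact_mod_cast hn
  have hAB := exists_dist_le_hausdorffDist hA hB
  have hBA := exists_dist_le_hausdorffDist hB hA
  rw [Metric.hausdorffDist_comm] at hBA
  exact Metric.hausdorffDist_le_of_mem_dist (mul_nonneg (by linarith) hD)
    (exists_mem_lineRetract_dist_le hn hAn hBn hD hAB hBA)
    (exists_mem_lineRetract_dist_le hn hBn hAn hD hBA hAB)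

/-- Corollary 4.3: every additive subgroup `G` of `ℝ` has the Lipschitz Clustering
Property, and so does the intersection of `G` with any interval `I` (intervals being
the order-connected subsets of `ℝ`): for each `n ≥ 2`, the explicit map
`r(A) = { x - δ_n(A) s_A(x) : x ∈ A }` restricts to a `(4n-3)`-Lipschitz retraction of
`G(n)` onto `G(n-1)` and of `(G ∩ I)(n)` onto `(G ∩ I)(n-1)`. -/
theorem addSubgroup_lipschitz_clustering (G : AddSubgroup ℝ) (I : Set ℝ)
    (hI : I.OrdConnected) (n : ℕ) (hn : 2 ≤ n) :
    ((∀ A : Finset ℝ, A.Nonempty → A.card ≤ n → (A : Set ℝ) ⊆ (G : Set ℝ) →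
        (lineRetract n A).Nonempty ∧ (lineRetract n A).card ≤ n - 1 ∧
          ((lineRetract n A : Finset ℝ) : Set ℝ) ⊆ (G : Set ℝ)) ∧
      (∀ A : Finset ℝ, A.Nonempty → A.card ≤ n - 1 → (A : Set ℝ) ⊆ (G : Set ℝ) →
        lineRetract n A = A) ∧
      (∀ A B : Finset ℝ, A.Nonempty → A.card ≤ n → (A : Set ℝ) ⊆ (G : Set ℝ) →
        B.Nonempty → B.card ≤ n → (B : Set ℝ) ⊆ (G : Set ℝ) →
        Metric.hausdorffDist ((lineRetract n A : Finset ℝ) : Set ℝ)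
            ((lineRetract n B : Finset ℝ) : Set ℝ) ≤
          (4 * (n : ℝ) - 3) * Metric.hausdorffDist (A : Set ℝ) (B : Set ℝ))) ∧
    ((∀ A : Finset ℝ, A.Nonempty → A.card ≤ n → (A : Set ℝ) ⊆ (G : Set ℝ) ∩ I →
        (lineRetract n A).Nonempty ∧ (lineRetract n A).card ≤ n - 1 ∧
          ((lineRetract n A : Finset ℝ) : Set ℝ) ⊆ (G : Set ℝ) ∩ I) ∧
      (∀ A : Finset ℝ, A.Nonempty → A.card ≤ n - 1 → (A : Set ℝ) ⊆ (G : Set ℝ) ∩ I →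
        lineRetract n A = A) ∧
      (∀ A B : Finset ℝ, A.Nonempty → A.card ≤ n → (A : Set ℝ) ⊆ (G : Set ℝ) ∩ I →
        B.Nonempty → B.card ≤ n → (B : Set ℝ) ⊆ (G : Set ℝ) ∩ I →
        Metric.hausdorffDist ((lineRetract n A : Finset ℝ) : Set ℝ)
            ((lineRetract n B : Finset ℝ) : Set ℝ) ≤
          (4 * (n : ℝ) - 3) * Metric.hausdorffDist (A : Set ℝ) (B : Set ℝ))) := by
  have hlip : ∀ A B : Finset ℝ, A.Nonempty → A.card ≤ n → B.Nonempty → B.card ≤ n →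
      Metric.hausdorffDist (lineRetract n A : Set ℝ) (lineRetract n B : Set ℝ) ≤
        (4 * (n : ℝ) - 3) * Metric.hausdorffDist (A : Set ℝ) (B : Set ℝ) := by
    intro A B hA hAn hB hBn
    have hn' : (2 : ℝ) ≤ n := by exact_mod_cast hn
    exact (hausdorffDist_lineRetract_le hn hA hAn hB hBn).trans
      (mul_le_mul_of_nonneg_right (by linarith) Metric.hausdorffDist_nonneg)
  refine ⟨⟨fun A hA hAn hAG => ?_, fun A _ hAn _ => lineRetract_of_card_ne (by omega),
    fun A B hA hAn _ hB hBn _ => hlip A B hA hAn hB hBn⟩,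
    fun A hA hAn hAG => ?_, fun A _ hAn _ => lineRetract_of_card_ne (by omega),
    fun A B hA hAn _ hB hBn _ => hlip A B hA hAn hB hBn⟩
  · exact ⟨hA.image _, card_lineRetract_le hn hAn, lineRetract_subset_addSubgroup hn G hAG⟩
  · obtain ⟨hG, hAI⟩ := Set.subset_inter_iff.1 hAG
    exact ⟨hA.image _, card_lineRetract_le hn hAn, Set.subset_inter
      (lineRetract_subset_addSubgroup hn G hG) (lineRetract_subset_ordConnected n hI hAI)⟩
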